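/- Fix an integer n ≥ 2, positive revision rates λ_1,…,λ_n, a positive normalization constant τ̄, and sign-preserving Lipschitz functions φ_1,…,φ_n defining an RM-PC protocol. Then for all x in the simplex X and all p ∈ ℝ^n, the storage function satisfies S(x,p) ≥ 0, and S(x,p) = 0 if and only if V(x,p) = 0. -/

import Mathlib

open scoped BigOperators
open Finset

noncomputable section

namespace RMPC

/-- The probability simplex in `ℝ^n`. -/
def simplex (n : ℕ) : Set (Fin n → ℝ) :=
  {x | (∀ i, 0 ≤ x i) ∧ ∑ i, x i = 1}

/-- A function `φ : ℝ → ℝ` is sign-preserving if it is positive on positive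
arguments and vanishes on nonpositive ones (hence takes values in `ℝ_{≥0}`). -/
def SignPreserving (φ : ℝ → ℝ) : Prop :=
  (∀ s : ℝ, 0 < s → 0 < φ s) ∧ (∀ s : ℝ, s ≤ 0 → φ s = 0)

/-- The RM-PC mean dynamics
`V_i(x,p) = Σ_{j≠i} λ_j (1/τ̄) φ_i(p_i − p_j) x_j − Σ_{j≠i} λ_i (1/τ̄) φ_j(p_j − p_i) x_i`. -/
def Vdyn (n : ℕ) (lam : Fin n → ℝ) (τ : ℝ) (φ : Fin n → ℝ → ℝ)
    (x p : Fin n → ℝ) (i : Fin n) : ℝ :=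
  (∑ j ∈ Finset.univ.erase i, lam j * (1 / τ) * φ i (p i - p j) * x j)
    - ∑ j ∈ Finset.univ.erase i, lam i * (1 / τ) * φ j (p j - p i) * x i

/-- `ψ(s) = ∫_0^s φ(r) dr`. -/
def psiF (φ : ℝ → ℝ) (s : ℝ) : ℝ := ∫ r in (0:ℝ)..s, φ r

/-- `γ_i(p) = Σ_k ψ_k(p_k − p_i)`. -/
def gammaF (n : ℕ) (φ : Fin n → ℝ → ℝ) (i : Fin n) (p : Fin n → ℝ) : ℝ :=
  ∑ k, psiF (φ k) (p k - p i)

/-- Worst-case revision rate ratio `λ_R = max { λ_i / λ_j }`. -/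
def lamR (n : ℕ) (lam : Fin n → ℝ) : ℝ :=
  ⨆ ij : Fin n × Fin n, lam ij.1 / lam ij.2

/-- The set of values `γ_k(p) Σ_i φ_i(p_i − p_k) / Σ_i φ_i(p_i − p_k) γ_i(p)`,
over `p` with nonvanishing denominator. -/
def thresholdSet (n : ℕ) (φ : Fin n → ℝ → ℝ) (k : Fin n) : Set ℝ :=
  {c | ∃ p : Fin n → ℝ,
    (∑ i, φ i (p i - p k) * gammaF n φ i p) ≠ 0 ∧
    c = (gammaF n φ k p * ∑ i, φ i (p i - p k)) /
        (∑ i, φ i (p i - p k) * gammaF n φ i p)}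

/-- The threshold `λ̄_φ(n)`. -/
def lamBar (n : ℕ) (φ : Fin n → ℝ → ℝ) : ℝ :=
  ⨅ k : Fin n, sInf (thresholdSet n φ k)

/-- The δ-storage function `S(x,p) = (1/τ̄) Σ_i λ_i x_i γ_i(p)`. -/
def Sfun (n : ℕ) (lam : Fin n → ℝ) (τ : ℝ) (φ : Fin n → ℝ → ℝ)
    (x p : Fin n → ℝ) : ℝ :=
  (1 / τ) * ∑ i, lam i * x i * gammaF n φ i p

/-- The dissipation rate `𝔖(x,p) = −(1/τ̄) Σ_i λ_i V_i(x,p) γ_i(p)`. -/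
def SigFun (n : ℕ) (lam : Fin n → ℝ) (τ : ℝ) (φ : Fin n → ℝ → ℝ)
    (x p : Fin n → ℝ) : ℝ :=
  -((1 / τ) * ∑ i, lam i * Vdyn n lam τ φ x p i * gammaF n φ i p)

lemma psi_nonpos_arg (f : ℝ → ℝ) (hf : SignPreserving f) (s : ℝ) (hs : s ≤ 0) :
    psiF f s = 0 := by
  unfold psiF
  rw [intervalIntegral.integral_symm, neg_eq_zero]
  apply intervalIntegral.integral_zero_ae
  refine Filter.Eventually.of_forall fun r hr => ?_
  rw [Set.uIoc_of_le hs] at hr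
  exact hf.2 r hr.2

lemma psi_pos (f : ℝ → ℝ) (hf : SignPreserving f) (hc : Continuous f) (s : ℝ) (hs : 0 < s) :
    0 < psiF f s := by
  unfold psiF
  exact intervalIntegral.intervalIntegral_pos_of_pos_on (hc.intervalIntegrable _ _)
    (fun r hr => hf.1 r hr.1) hs

lemma psi_nonneg (f : ℝ → ℝ) (hf : SignPreserving f) (hc : Continuous f) (s : ℝ) :
    0 ≤ psiF f s := by
  rcases le_or_gt s 0 with h | h
  · exact (psi_nonpos_arg f hf s h).ge
  · exact (psi_pos f hf hc s h).le

lemma phi_nonneg (f : ℝ → ℝ) (hf : SignPreserving f) (s : ℝ) : 0 ≤ f s := by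
  rcases le_or_gt s 0 with h | h
  · exact (hf.2 s h).ge
  · exact (hf.1 s h).le

/-- The storage function is nonnegative and vanishes exactly where the mean
dynamics vanish. -/
theorem storage_nonneg_and_zero_iff (n : ℕ) (hn : 2 ≤ n)
    (lam : Fin n → ℝ) (hlam : ∀ i, 0 < lam i)
    (τ : ℝ) (hτ : 0 < τ)
    (φ : Fin n → ℝ → ℝ)
    (hφ : ∀ j, SignPreserving (φ j))
    (hLip : ∀ j, ∃ K, LipschitzWith K (φ j)) :
    ∀ x ∈ simplex n, ∀ p : Fin n → ℝ,
      0 ≤ Sfun n lam τ φ x p ∧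
      (Sfun n lam τ φ x p = 0 ↔ ∀ i, Vdyn n lam τ φ x p i = 0) := by
  intro x hx p
  have hc : ∀ j, Continuous (φ j) := fun j => by
    obtain ⟨K, hK⟩ := hLip j
    exact hK.continuous
  have hg : ∀ i, 0 ≤ gammaF n φ i p := fun i =>
    Finset.sum_nonneg fun k _ => psi_nonneg _ (hφ k) (hc k) _
  have ht : ∀ i, 0 ≤ lam i * x i * gammaF n φ i p := fun i =>
    mul_nonneg (mul_nonneg (hlam i).le (hx.1 i)) (hg i)
  have hτ' : 0 < 1 / τ := by positivity
  refine ⟨mul_nonneg hτ'.le (Finset.sum_nonneg fun i _ => ht i), ?_⟩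
  have hS : Sfun n lam τ φ x p = 0 ↔ ∀ i k, p i < p k → x i = 0 := by
    unfold Sfun
    rw [mul_eq_zero, or_iff_right hτ'.ne', Finset.sum_eq_zero_iff_of_nonneg fun i _ => ht i]
    constructor
    · intro h i k hik
      have h1 := h i (Finset.mem_univ i)
      have h2 : 0 < gammaF n φ i p :=
        Finset.sum_pos' (fun k _ => psi_nonneg _ (hφ k) (hc k) _)
          ⟨k, Finset.mem_univ k, psi_pos _ (hφ k) (hc k) _ (by linarith)⟩
      simpa [(hlam i).ne', h2.ne'] using h1
    · intro h i _
      by_cases hi : x i = 0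
      · simp [hi]
      · have : gammaF n φ i p = 0 := Finset.sum_eq_zero fun k _ =>
          psi_nonpos_arg _ (hφ k) _ (by
            by_contra hh
            exact hi (h i k (by linarith)))
        simp [this]
  rw [hS]
  set f : Fin n → Fin n → ℝ := fun i j => lam j * (1 / τ) * φ i (p i - p j) * x j with hf
  have hfd : ∀ i, f i i = 0 := fun i => by simp [hf, (hφ i).2 0 le_rfl]
  have hV : ∀ i, Vdyn n lam τ φ x p i = ∑ j, f i j - ∑ j, f j i := by
    intro i
    rw [← Finset.sum_erase (f := fun j => f i j) Finset.univ (hfd i),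
      ← Finset.sum_erase (f := fun j => f j i) Finset.univ (hfd i)]
    rfl
  constructor
  · intro h i
    have h0 : ∀ i j, f i j = 0 := by
      intro i j
      rcases le_or_gt (p i - p j) 0 with hh | hh
      · simp [hf, (hφ i).2 _ hh]
      · simp [hf, h j i (by linarith)]
    rw [hV]
    simp [h0]
  · intro h i k hik
    have key : ∑ i, ∑ j, (p i - p j) * f i j = 0 := by
      have e : ∑ i, p i * Vdyn n lam τ φ x p i = 0 := by simp [h]
      simp only [hV, mul_sub, Finset.sum_sub_distrib, Finset.mul_sum] at e
      simp only [sub_mul, Finset.sum_sub_distrib]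
      rw [← e]
      congr 1
      exact Finset.sum_comm
    have nn : ∀ i j, 0 ≤ (p i - p j) * f i j := by
      intro i j
      rcases le_or_gt (p i - p j) 0 with hh | hh
      · simp [hf, (hφ i).2 _ hh]
      · exact mul_nonneg hh.le (mul_nonneg (mul_nonneg (mul_nonneg (hlam j).le hτ'.le)
          (phi_nonneg _ (hφ i) _)) (hx.1 j))
    rw [Finset.sum_eq_zero_iff_of_nonneg fun i _ => Finset.sum_nonneg fun j _ => nn i j] at key
    have k1 := key k (Finset.mem_univ k)
    rw [Finset.sum_eq_zero_iff_of_nonneg fun j _ => nn k j] at k1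
    have k2 := k1 i (Finset.mem_univ i)
    have hd : 0 < p k - p i := by linarith
    have hp := (hφ k).1 _ hd
    simpa [hf, hd.ne', hp.ne', (hlam i).ne', hτ.ne'] using k2

end RMPC
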